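/- arXiv:math/0601463 — 2 statements merged into one kernel-verified Lean document; each statement's English description precedes it below -/
import Mathlib

section
/- For every integer n (positive, negative, or zero), Σ_{N ≥ |n|} (−aq;q)_n (−q^n/a;q)_{N−n} q^{N(N+1)/2 − n(n+1)/2} a^{N−n} / ((q;q)_{N+n} (q;q)_{N−n}) = (−aq;q)_∞ / (q;q)_∞, for complex a, q with 0 < |q| < 1 and a such that all Pochhammer symbols appearing are nonzero (e.g. a > 0 real). -/
namespace Paper

open scoped Classical

/-- The infinite q-Pochhammer symbol `(x;q)_∞ = ∏_{i≥0} (1 - x qⁱ)`. -/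
noncomputable def qPochInf (x q : ℂ) : ℂ := ∏' i : ℕ, (1 - x * q ^ i)

/-- The finite q-Pochhammer symbol `(x;q)_N = ∏_{i=0}^{N-1} (1 - x qⁱ)`. -/
noncomputable def qPochN (x q : ℂ) (N : ℕ) : ℂ := ∏ i ∈ Finset.range N, (1 - x * q ^ i)

/-- The q-Pochhammer symbol with arbitrary integer index,
`(x;q)_n = (x;q)_∞ / (x qⁿ;q)_∞`. -/
noncomputable def qPochZ (x q : ℂ) (n : ℤ) : ℂ := qPochInf x q / qPochInf (x * q ^ n) q

open Filter Topology

section Pochhammer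

variable {q : ℂ}

lemma summable_norm_neg_mul_pow (hq1 : ‖q‖ < 1) (x : ℂ) :
    Summable fun i : ℕ => ‖-(x * q ^ i)‖ := by
  simpa using (summable_geometric_of_lt_one (norm_nonneg q) hq1).mul_left ‖x‖

lemma multipliable_one_sub_mul_pow (hq1 : ‖q‖ < 1) (x : ℂ) :
    Multipliable fun i : ℕ => 1 - x * q ^ i := by
  simpa [sub_eq_add_neg] using multipliable_one_add_of_summable (summable_norm_neg_mul_pow hq1 x)

lemma tendsto_qPochN (hq1 : ‖q‖ < 1) (x : ℂ) :
    Tendsto (qPochN x q) atTop (𝓝 (qPochInf x q)) :=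
  (multipliable_one_sub_mul_pow hq1 x).tendsto_prod_tprod_nat

lemma qPochN_mul_qPochInf (hq1 : ‖q‖ < 1) (x : ℂ) (N : ℕ) :
    qPochN x q N * qPochInf (x * q ^ N) q = qPochInf x q := by
  have h : ∀ i : ℕ, 1 - x * q ^ N * q ^ i = 1 - x * q ^ (i + N) := fun i => by ring
  have hm := multipliable_one_sub_mul_pow hq1 (x * q ^ N)
  simp only [h] at hm
  simp only [qPochN, qPochInf, h]
  exact hm.prod_mul_tprod_nat_mul' (f := fun i => 1 - x * q ^ i)

lemma qPochZ_natCast (hq1 : ‖q‖ < 1) (x : ℂ) (N : ℕ) (h : qPochInf (x * q ^ N) q ≠ 0) :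
    qPochZ x q N = qPochN x q N := by
  rw [qPochZ, zpow_natCast, div_eq_iff h, qPochN_mul_qPochInf hq1]

lemma qPochN_add (x : ℂ) (M N : ℕ) :
    qPochN x q (M + N) = qPochN x q M * qPochN (x * q ^ M) q N := by
  simp only [qPochN, Finset.prod_range_add]
  congr 1
  exact Finset.prod_congr rfl fun i _ => by ring

lemma one_sub_mul_pow_succ_ne_zero (hq1 : ‖q‖ < 1) {y : ℂ} (hy : ‖y‖ ≤ 1) (i : ℕ) :
    1 - y * q ^ (i + 1) ≠ 0 := by
  have h : ‖y * q ^ (i + 1)‖ < 1 := by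
    rw [norm_mul, norm_pow]
    exact (mul_le_of_le_one_left (by positivity) hy).trans_lt
      (pow_lt_one₀ (norm_nonneg q) hq1 (Nat.succ_ne_zero i))
  intro h0
  rw [← sub_eq_zero.1 h0] at h
  simp at h

lemma one_sub_norm_le (hq1 : ‖q‖ < 1) {y : ℂ} (hy : ‖y‖ ≤ 1) (i : ℕ) :
    1 - ‖q‖ ≤ ‖1 - y * q ^ (i + 1)‖ := by
  have h : ‖y * q ^ (i + 1)‖ ≤ ‖q‖ := by
    rw [norm_mul, norm_pow]
    exact (mul_le_of_le_one_left (by positivity) hy).trans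
      (pow_le_of_le_one (norm_nonneg q) hq1.le (Nat.succ_ne_zero i))
  have := norm_sub_norm_le (1 : ℂ) (y * q ^ (i + 1))
  rw [norm_one] at this
  linarith

lemma qPochInf_mul_self_ne_zero (hq1 : ‖q‖ < 1) {y : ℂ} (hy : ‖y‖ ≤ 1) :
    qPochInf (y * q) q ≠ 0 := by
  have := tprod_one_add_ne_zero_of_summable (f := fun i : ℕ => -(y * q * q ^ i))
    (fun i => by
      have := one_sub_mul_pow_succ_ne_zero hq1 hy i
      rwa [pow_succ', ← mul_assoc, sub_eq_add_neg] at this)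
    (summable_norm_neg_mul_pow hq1 _)
  simpa [qPochInf, sub_eq_add_neg] using this

end Pochhammer

section GaussSum

variable {q : ℂ}

/-- The summand `∏_{i<k} (z + y qⁱ) · q^{k(k+1)/2} / ((q;q)_k (yq;q)_k)` of the confluent
`q`-Gauss sum. -/
noncomputable def gaussTerm (q z y : ℂ) (k : ℕ) : ℂ :=
  ∏ i ∈ Finset.range k,
    (z + y * q ^ i) * q ^ (i + 1) / ((1 - q ^ (i + 1)) * (1 - y * q ^ (i + 1)))

/-- A majorant of `gaussTerm`. -/
noncomputable def gaussBound (M r : ℝ) (k : ℕ) : ℝ := ∏ i ∈ Finset.range k, M * r ^ (i + 1)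

lemma summable_gaussBound {M r : ℝ} (hM : 0 < M) (hr0 : 0 < r) (hr1 : r < 1) :
    Summable (gaussBound M r) := by
  have hpos : ∀ k, 0 < gaussBound M r k := fun k => Finset.prod_pos fun i _ => by positivity
  refine summable_of_ratio_test_tendsto_lt_one zero_lt_one
    (Eventually.of_forall fun k => (hpos k).ne') ?_
  have h : ∀ k, ‖gaussBound M r (k + 1)‖ / ‖gaussBound M r k‖ = M * r ^ (k + 1) := fun k => by
    rw [Real.norm_of_nonneg (hpos _).le, Real.norm_of_nonneg (hpos _).le,
      div_eq_iff (hpos k).ne', gaussBound, Finset.prod_range_succ, mul_comm]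
    rfl
  simp only [h]
  simpa using ((tendsto_pow_atTop_nhds_zero_of_lt_one hr0.le hr1).comp
    (tendsto_add_atTop_nat 1)).const_mul M

lemma norm_gaussTerm_le (hq1 : ‖q‖ < 1) {z y : ℂ} {R : ℝ} (hz : ‖z‖ ≤ R) (hy : ‖y‖ ≤ 1) (k : ℕ) :
    ‖gaussTerm q z y k‖ ≤ gaussBound ((R + 1) / (1 - ‖q‖) ^ 2) ‖q‖ k := by
  rw [gaussTerm, norm_prod, gaussBound]
  refine Finset.prod_le_prod (fun i _ => norm_nonneg _) fun i _ => ?_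
  have h1 := one_sub_norm_le hq1 hy i
  have h2 := one_sub_norm_le hq1 (y := 1) (by simp) i
  rw [one_mul] at h2
  have h3 : ‖z + y * q ^ i‖ ≤ R + 1 := by
    refine (norm_add_le _ _).trans (add_le_add hz ?_)
    rw [norm_mul, norm_pow]
    exact mul_le_one₀ hy (by positivity) (pow_le_one₀ (norm_nonneg q) hq1.le)
  have hpos : 0 < 1 - ‖q‖ := by linarith
  have hR : 0 ≤ R + 1 := (norm_nonneg _).trans h3
  rw [norm_div, norm_mul, norm_mul, norm_pow, div_mul_eq_mul_div, sq]
  gcongr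

lemma summable_gaussTerm (hq0 : 0 < ‖q‖) (hq1 : ‖q‖ < 1) (z : ℂ) {y : ℂ} (hy : ‖y‖ ≤ 1) :
    Summable (gaussTerm q z y) := by
  have hpos : 0 < 1 - ‖q‖ := by linarith
  exact (summable_gaussBound (M := (‖z‖ + 1) / (1 - ‖q‖) ^ 2) (by positivity) hq0
    hq1).of_norm_bounded (norm_gaussTerm_le hq1 le_rfl hy)

lemma gaussTerm_succ (z y : ℂ) (k : ℕ) :
    gaussTerm q z y (k + 1) = gaussTerm q z y k *
      ((z + y * q ^ k) * q ^ (k + 1) / ((1 - q ^ (k + 1)) * (1 - y * q ^ (k + 1)))) :=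
  Finset.prod_range_succ _ _

lemma one_sub_mul_gaussTerm_shift (hq1 : ‖q‖ < 1) (z : ℂ) {y : ℂ} (hy : ‖y‖ ≤ 1) (k : ℕ) :
    (1 - y * q ^ (k + 1)) * gaussTerm q (z * q) (y * q) k =
      (1 - y * q) * q ^ k * gaussTerm q z y k := by
  induction k with
  | zero => simp [gaussTerm]
  | succ k ih =>
    have h1 := one_sub_mul_pow_succ_ne_zero hq1 hy k
    have h2 := one_sub_mul_pow_succ_ne_zero hq1 hy (k + 1)
    have h3 := one_sub_mul_pow_succ_ne_zero hq1 (y := 1) (by simp) k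
    rw [one_mul] at h3
    have e : y * q * q ^ (k + 1) = y * q ^ (k + 1 + 1) := by ring
    rw [gaussTerm_succ, gaussTerm_succ, e]
    rw [mul_comm, ← eq_div_iff h1] at ih
    rw [ih]
    field_simp
    ring

/-- The telescoping identity behind the contiguous relation for the confluent `q`-Gauss sum. -/
lemma gaussTerm_telescope (hq1 : ‖q‖ < 1) (z : ℂ) {y : ℂ} (hy : ‖y‖ ≤ 1) (k : ℕ) :
    (1 - y * q) * gaussTerm q z y k - (1 + z * q) * gaussTerm q (z * q) (y * q) k =
      (1 - y * q) * ((1 - q ^ k) * gaussTerm q z y k -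
        (1 - q ^ (k + 1)) * gaussTerm q z y (k + 1)) := by
  have h1 := one_sub_mul_pow_succ_ne_zero hq1 hy k
  have h3 := one_sub_mul_pow_succ_ne_zero hq1 (y := 1) (by simp) k
  rw [one_mul] at h3
  have h := one_sub_mul_gaussTerm_shift hq1 z hy k
  rw [mul_comm, ← eq_div_iff h1] at h
  rw [gaussTerm_succ, h]
  field_simp
  ring

lemma tsum_gaussTerm_shift (hq0 : 0 < ‖q‖) (hq1 : ‖q‖ < 1) (z : ℂ) {y : ℂ} (hy : ‖y‖ ≤ 1) :
    (1 - y * q) * ∑' k, gaussTerm q z y k =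
      (1 + z * q) * ∑' k, gaussTerm q (z * q) (y * q) k := by
  have hyq : ‖y * q‖ ≤ 1 := by
    rw [norm_mul]; exact mul_le_one₀ hy (norm_nonneg q) hq1.le
  have hs := summable_gaussTerm hq0 hq1 z hy
  have hs' := summable_gaussTerm hq0 hq1 (z * q) hyq
  have hw : Summable fun k => (1 - q ^ k) * gaussTerm q z y k := by
    refine (hs.norm.mul_left 2).of_norm_bounded fun k => ?_
    rw [norm_mul]
    gcongr
    refine (norm_sub_le _ _).trans ?_
    rw [norm_one, norm_pow]
    linarith [pow_le_one₀ (n := k) (norm_nonneg q) hq1.le]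
  have hw' := (summable_nat_add_iff 1).2 hw
  rw [← sub_eq_zero, ← tsum_mul_left, ← tsum_mul_left,
    ← (hs.mul_left _).tsum_sub (hs'.mul_left _)]
  simp only [gaussTerm_telescope hq1 z hy]
  rw [tsum_mul_left, hw.tsum_sub hw', hw.tsum_eq_zero_add]
  simp

lemma qPochN_mul_tsum_gaussTerm (hq0 : 0 < ‖q‖) (hq1 : ‖q‖ < 1) (z : ℂ) {y : ℂ} (hy : ‖y‖ ≤ 1)
    (n : ℕ) :
    qPochN (y * q) q n * ∑' k, gaussTerm q z y k =
      qPochN (-(z * q)) q n * ∑' k, gaussTerm q (z * q ^ n) (y * q ^ n) k := by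
  induction n with
  | zero => simp [qPochN]
  | succ n ih =>
    have hyn : ‖y * q ^ n‖ ≤ 1 := by
      rw [norm_mul, norm_pow]
      exact mul_le_one₀ hy (by positivity) (pow_le_one₀ (norm_nonneg q) hq1.le)
    have h := tsum_gaussTerm_shift hq0 hq1 (z * q ^ n) hyn
    rw [mul_assoc, mul_assoc, ← pow_succ] at h
    have e1 : qPochN (y * q) q (n + 1) = qPochN (y * q) q n * (1 - y * q ^ (n + 1)) := by
      rw [qPochN, Finset.prod_range_succ, pow_succ', ← mul_assoc]; rfl
    have e2 : qPochN (-(z * q)) q (n + 1) = qPochN (-(z * q)) q n * (1 + z * q ^ (n + 1)) := by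
      rw [qPochN, Finset.prod_range_succ, pow_succ', ← mul_assoc, neg_mul, sub_neg_eq_add]; rfl
    rw [e1, e2, mul_right_comm, ih, mul_right_comm, mul_assoc, mul_assoc, h]

lemma tendsto_gaussTerm (hq1 : ‖q‖ < 1) (z y : ℂ) (k : ℕ) :
    Tendsto (fun n : ℕ => gaussTerm q (z * q ^ n) (y * q ^ n) k) atTop
      (𝓝 (gaussTerm q 0 0 k)) := by
  have hp := tendsto_pow_atTop_nhds_zero_of_norm_lt_one hq1
  have hz : Tendsto (fun n : ℕ => z * q ^ n) atTop (𝓝 0) := by simpa using hp.const_mul z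
  have hy : Tendsto (fun n : ℕ => y * q ^ n) atTop (𝓝 0) := by simpa using hp.const_mul y
  refine tendsto_finsetProd _ fun i _ => ?_
  refine ((hz.add (hy.mul_const _)).mul_const _).div
    (((hy.mul_const _).const_sub 1).const_mul _) ?_
  have h3 := one_sub_mul_pow_succ_ne_zero hq1 (y := 1) (by simp) i
  simpa using h3

/-- The confluent `q`-Gauss sum. -/
lemma tsum_gaussTerm (hq0 : 0 < ‖q‖) (hq1 : ‖q‖ < 1) (z : ℂ) {y : ℂ} (hy : ‖y‖ ≤ 1) :
    ∑' k, gaussTerm q z y k = qPochInf (-(z * q)) q / qPochInf (y * q) q := by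
  have hpos : 0 < 1 - ‖q‖ := by linarith
  have hlim : Tendsto (fun n : ℕ => ∑' k, gaussTerm q (z * q ^ n) (y * q ^ n) k) atTop
      (𝓝 (∑' k, gaussTerm q 0 0 k)) := by
    refine tendsto_tsum_of_dominated_convergence
      (summable_gaussBound (M := (‖z‖ + 1) / (1 - ‖q‖) ^ 2) (by positivity) hq0 hq1)
      (tendsto_gaussTerm hq1 z y) (Eventually.of_forall fun n k => ?_)
    have hn : ‖q‖ ^ n ≤ 1 := pow_le_one₀ (norm_nonneg q) hq1.le
    refine norm_gaussTerm_le hq1 ?_ ?_ k <;> rw [norm_mul, norm_pow]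
    · exact mul_le_of_le_one_right (norm_nonneg z) hn
    · exact mul_le_one₀ hy (by positivity) hn
  have h0 : ∑' k, gaussTerm q 0 0 k = 1 := by
    rw [tsum_eq_single 0 fun k hk => ?_]
    · simp [gaussTerm]
    · exact Finset.prod_eq_zero (Finset.mem_range.2 (Nat.pos_of_ne_zero hk)) (by simp)
  rw [h0] at hlim
  rw [eq_div_iff (qPochInf_mul_self_ne_zero hq1 hy), mul_comm]
  refine tendsto_nhds_unique ((tendsto_qPochN hq1 (y * q)).mul_const _) ?_
  simp only [qPochN_mul_tsum_gaussTerm hq0 hq1 z hy]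
  simpa using (tendsto_qPochN hq1 (-(z * q))).mul hlim

end GaussSum

section Reduction

variable {q : ℂ}

lemma prod_pow_succ_range (q : ℂ) (k : ℕ) :
    ∏ i ∈ Finset.range k, q ^ (i + 1) = q ^ (k * (k + 1) / 2) := by
  rw [Finset.prod_pow_eq_pow_sum]
  congr 1
  have h := Finset.sum_range_id (k + 1)
  rw [Finset.sum_range_succ'] at h
  simpa [mul_comm] using h

lemma gaussTerm_eq (q : ℂ) {a : ℂ} (ha : a ≠ 0) (m k : ℕ) :
    gaussTerm q (a * q ^ m) (q ^ (2 * m)) k =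
      qPochN (-(q ^ m / a)) q k * q ^ (m * k + k * (k + 1) / 2) * a ^ k /
        (qPochN q q k * qPochN (q * q ^ (2 * m)) q k) := by
  have e : ∀ x : ℂ, x ^ k = ∏ _i ∈ Finset.range k, x := fun x => by simp
  rw [pow_add, pow_mul q m k, e a, e (q ^ m), ← prod_pow_succ_range]
  simp only [gaussTerm, qPochN, ← Finset.prod_mul_distrib, ← Finset.prod_div_distrib]
  refine Finset.prod_congr rfl fun i _ => ?_
  have h1 : (a * q ^ m + q ^ (2 * m) * q ^ i) * q ^ (i + 1) =
      (1 - -(q ^ m / a) * q ^ i) * (q ^ m * q ^ (i + 1)) * a := by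
    field_simp
    ring
  have h2 : q ^ (2 * m) * q ^ (i + 1) = q * q ^ (2 * m) * q ^ i := by ring
  rw [h1, h2, pow_succ' q i]

lemma qPochZ_self (hq1 : ‖q‖ < 1) (N : ℕ) : qPochZ q q N = qPochN q q N := by
  refine qPochZ_natCast hq1 q N ?_
  rw [mul_comm]
  exact qPochInf_mul_self_ne_zero hq1
    (by rw [norm_pow]; exact pow_le_one₀ (norm_nonneg q) hq1.le)

/-- The super-Durfee sum for a nonnegative index, after the shift `N = m + k`. -/
lemma tsum_durfee (hq0 : 0 < ‖q‖) (hq1 : ‖q‖ < 1) {a : ℂ} (ha : a ≠ 0) (m : ℕ) :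
    ∑' k : ℕ, qPochN (-(q ^ m / a)) q k * q ^ (m * k + k * (k + 1) / 2) * a ^ k /
        (qPochN q q (2 * m + k) * qPochN q q k) =
      qPochInf (-(a * q) * q ^ m) q / qPochInf q q := by
  have hy : ‖q ^ (2 * m)‖ ≤ 1 := by
    rw [norm_pow]; exact pow_le_one₀ (norm_nonneg q) hq1.le
  have h := tsum_gaussTerm hq0 hq1 (a * q ^ m) hy
  rw [mul_comm (q ^ (2 * m)) q] at h
  have e : ∀ k : ℕ, qPochN (-(q ^ m / a)) q k * q ^ (m * k + k * (k + 1) / 2) * a ^ k /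
      (qPochN q q (2 * m + k) * qPochN q q k) =
      (qPochN q q (2 * m))⁻¹ * gaussTerm q (a * q ^ m) (q ^ (2 * m)) k := fun k => by
    rw [gaussTerm_eq q ha, qPochN_add, mul_assoc (qPochN q q (2 * m)), inv_mul_eq_div, div_div,
      mul_comm (qPochN (q * q ^ (2 * m)) q k), mul_comm (qPochN q q (2 * m))]
  simp only [e]
  rw [tsum_mul_left, h, inv_mul_eq_div, div_div, mul_comm (qPochInf _ _) (qPochN _ _ _),
    qPochN_mul_qPochInf hq1]
  congr 2
  ring

lemma prod_zpow_sub_range (hq : q ≠ 0) (m : ℕ) :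
    ∏ i ∈ Finset.range (2 * m), q ^ ((i : ℤ) - m) = q ^ (-(m : ℤ)) := by
  have e : q ^ (-(m : ℤ)) = ∏ _i ∈ Finset.range m, q⁻¹ := by simp
  rw [two_mul, Finset.prod_range_add, ← Finset.prod_range_reflect, ← Finset.prod_mul_distrib, e]
  refine Finset.prod_congr rfl fun i hi => ?_
  have hi := Finset.mem_range.1 hi
  rw [← zpow_add₀ hq, ← zpow_neg_one]
  congr 1
  push_cast [Nat.sub_sub, Nat.cast_sub (show 1 + i ≤ m by omega)]
  ring

/-- Reversal of a `q`-Pochhammer symbol that is symmetric about its centre. -/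
lemma qPochN_reverse (hq : q ≠ 0) {a : ℂ} (ha : a ≠ 0) (m : ℕ) :
    qPochN (-(q ^ (-(m : ℤ)) / a)) q (2 * m) * a ^ (2 * m) * q ^ m =
      qPochN (-(a * q) * q ^ (-(m : ℤ))) q (2 * m) := by
  have e : a ^ (2 * m) = ∏ _i ∈ Finset.range (2 * m), a := by simp
  have hr : qPochN (-(a * q) * q ^ (-(m : ℤ))) q (2 * m) =
      ∏ i ∈ Finset.range (2 * m), (1 + a * q ^ ((m : ℤ) - i)) := by
    rw [qPochN, ← Finset.prod_range_reflect]
    refine Finset.prod_congr rfl fun i hi => ?_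
    have hi := Finset.mem_range.1 hi
    have : q ^ ((m : ℤ) - i) = q * q ^ (-(m : ℤ)) * q ^ (2 * m - 1 - i) := by
      rw [← zpow_natCast q (2 * m - 1 - i), ← zpow_one_add₀ hq, ← zpow_add₀ hq]
      congr 1
      push_cast [Nat.sub_sub, Nat.cast_sub (show 1 + i ≤ 2 * m by omega)]
      ring
    rw [this]
    ring
  have hl : qPochN (-(q ^ (-(m : ℤ)) / a)) q (2 * m) * a ^ (2 * m) =
      q ^ (-(m : ℤ)) * ∏ i ∈ Finset.range (2 * m), (1 + a * q ^ ((m : ℤ) - i)) := by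
    rw [e, qPochN, ← Finset.prod_mul_distrib,
      ← prod_zpow_sub_range hq m, ← Finset.prod_mul_distrib]
    refine Finset.prod_congr rfl fun i _ => ?_
    rw [prod_zpow_sub_range hq, zpow_sub₀ hq, zpow_sub₀ hq, zpow_neg, zpow_natCast, zpow_natCast]
    field_simp
    ring
  rw [hl, hr, zpow_neg, zpow_natCast]
  field_simp

lemma tsum_ite_le (m : ℕ) (f : ℕ → ℂ) :
    ∑' N, (if m ≤ N then f N else 0) = ∑' k, f (m + k) := by
  rw [← (add_right_injective m).tsum_eq (f := fun N => if m ≤ N then f N else 0)]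
  · simp
  · intro N hN
    by_cases h : m ≤ N
    · exact ⟨N - m, Nat.add_sub_cancel' h⟩
    · simp [h] at hN

lemma mul_succ_div_two_sub (m k : ℕ) :
    ((m + k : ℕ) : ℤ) * (((m + k : ℕ) : ℤ) + 1) / 2 - (m : ℤ) * (m + 1) / 2 =
      ((m * k + k * (k + 1) / 2 : ℕ) : ℤ) := by
  obtain ⟨s, hs⟩ := (Int.even_mul_succ_self (m : ℤ)).two_dvd
  obtain ⟨t, ht⟩ := (Int.even_mul_succ_self (k : ℤ)).two_dvd
  have h : ((m + k : ℕ) : ℤ) * (((m + k : ℕ) : ℤ) + 1) = 2 * (s + t + m * k) := by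
    push_cast
    linear_combination hs + ht
  push_cast
  push_cast at h
  rw [h, hs, ht]
  simp only [Int.mul_ediv_cancel_left _ (two_ne_zero (α := ℤ))]
  ring

lemma mul_succ_div_two_sub_neg (m k : ℕ) :
    ((m + k : ℕ) : ℤ) * (((m + k : ℕ) : ℤ) + 1) / 2 - (-(m : ℤ)) * (-m + 1) / 2 =
      ((m + (m * k + k * (k + 1) / 2) : ℕ) : ℤ) := by
  have h : (-(m : ℤ)) * (-m + 1) / 2 = (m : ℤ) * (m + 1) / 2 - m := by
    rw [← Int.sub_mul_ediv_right _ _ two_ne_zero]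
    congr 1
    ring
  have := mul_succ_div_two_sub m k
  rw [h, Nat.cast_add m (m * k + _), ← this]
  ring

end Reduction

/-- **Proposition 3.3.** For every integer `n`,
`Σ_{N ≥ |n|} (-aq;q)_n (-qⁿ/a;q)_{N-n} q^{N(N+1)/2 - n(n+1)/2} a^{N-n} / ((q;q)_{N+n}(q;q)_{N-n})
 = (-aq;q)_∞/(q;q)_∞`. -/
theorem super_durfee (n : ℤ) (a q : ℂ) (hq0 : 0 < ‖q‖) (hq1 : ‖q‖ < 1) (ha : a ≠ 0)
    (hpoch1 : ∀ m : ℤ, qPochZ (-(a * q)) q m ≠ 0)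
    (hpoch2 : ∀ m : ℤ, qPochZ (-(q ^ n / a)) q m ≠ 0) :
    (∑' N : ℕ, if n.natAbs ≤ N then
        qPochZ (-(a * q)) q n * qPochZ (-(q ^ n / a)) q ((N : ℤ) - n) *
          q ^ ((N : ℤ) * ((N : ℤ) + 1) / 2 - n * (n + 1) / 2) * a ^ ((N : ℤ) - n) /
            (qPochZ q q ((N : ℤ) + n) * qPochZ q q ((N : ℤ) - n))
      else 0) =
      qPochInf (-(a * q)) q / qPochInf q q := by
  have hq : q ≠ 0 := norm_pos_iff.1 hq0
  have hden1 : ∀ m : ℤ, qPochInf (-(a * q) * q ^ m) q ≠ 0 := fun m =>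
    (div_ne_zero_iff.1 (hpoch1 m)).2
  have hden2 : ∀ k : ℕ, qPochZ (-(q ^ n / a)) q k = qPochN (-(q ^ n / a)) q k := fun k =>
    qPochZ_natCast hq1 _ k (by simpa using (div_ne_zero_iff.1 (hpoch2 k)).2)
  rw [tsum_ite_le]
  obtain ⟨m, rfl | rfl⟩ := n.eq_nat_or_neg
  · rw [Int.natAbs_natCast]
    have e1 : ∀ k : ℕ, ((m + k : ℕ) : ℤ) - m = (k : ℕ) := fun k => by push_cast; ring
    have e2 : ∀ k : ℕ, ((m + k : ℕ) : ℤ) + m = (2 * m + k : ℕ) := fun k => by push_cast; ring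
    have hterm : ∀ x y z w : ℂ, qPochZ (-(a * q)) q m * x * y * z / w =
        qPochZ (-(a * q)) q m * (x * y * z / w) := fun x y z w => by ring
    simp only [zpow_natCast] at hden2
    simp only [e1, e2, mul_succ_div_two_sub, qPochZ_self hq1, zpow_natCast, hterm, hden2]
    rw [tsum_mul_left, tsum_durfee hq0 hq1 ha, qPochZ, zpow_natCast, ← mul_div_assoc,
      div_mul_cancel₀ _ (by simpa using hden1 m)]
  · rw [Int.natAbs_neg, Int.natAbs_natCast]
    have e1 : ∀ k : ℕ, ((m + k : ℕ) : ℤ) - -(m : ℤ) = (2 * m + k : ℕ) := fun k => by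
      push_cast; ring
    have e2 : ∀ k : ℕ, ((m + k : ℕ) : ℤ) + -(m : ℤ) = (k : ℕ) := fun k => by push_cast; ring
    have e3 : -(q ^ (-(m : ℤ)) / a) * q ^ (2 * m) = -(q ^ m / a) := by
      rw [zpow_neg, zpow_natCast]
      field_simp
      ring
    have hterm : ∀ k : ℕ, qPochZ (-(a * q)) q (-m) *
        (qPochN (-(q ^ (-(m : ℤ)) / a)) q (2 * m) * qPochN (-(q ^ m / a)) q k) *
        q ^ (m + (m * k + k * (k + 1) / 2)) * a ^ (2 * m + k) /
          (qPochN q q k * qPochN q q (2 * m + k)) =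
        (qPochZ (-(a * q)) q (-m) * qPochN (-(a * q) * q ^ (-(m : ℤ))) q (2 * m)) *
        (qPochN (-(q ^ m / a)) q k * q ^ (m * k + k * (k + 1) / 2) * a ^ k /
          (qPochN q q (2 * m + k) * qPochN q q k)) := fun k => by
      rw [← qPochN_reverse hq ha, mul_comm (qPochN q q k)]
      ring
    simp only [e1, e2, hden2, mul_succ_div_two_sub_neg, qPochZ_self hq1, zpow_natCast,
      qPochN_add _ (2 * m), e3]
    simp only [← qPochN_add _ (2 * m), hterm]
    have e4 : -(a * q) * q ^ m = -(a * q) * q ^ (-(m : ℤ)) * q ^ (2 * m) := by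
      rw [zpow_neg, zpow_natCast]
      field_simp
      ring
    rw [tsum_mul_left, tsum_durfee hq0 hq1 ha, e4, ← mul_div_assoc, mul_assoc,
      qPochN_mul_qPochInf hq1, qPochZ, div_mul_cancel₀ _ (hden1 _)]

end Paper
end

section
/- For all integers k ≥ i ≥ 1 and all nonnegative integers n, j, N, the number of paths with major index n, j South steps, and exactly N peaks satisfying the special (k,i)-conditions equals the number of overpartitions of n whose Frobenius representation has N columns and j non-overlined parts in the bottom row, and whose successive ranks all lie in the interval [−i+2, 2k−i−1]. -/
namespace Paper

/-- The four kinds of unitary steps. -/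
inductive PStep : Type
  | NE | SE | S | E
  deriving DecidableEq, BEq, Repr

/-- Horizontal displacement of a step. -/
def stepDx : PStep → ℕ
  | .S => 0
  | _ => 1

/-- Vertical displacement of a step. -/
def stepDy : PStep → ℤ
  | .NE => 1
  | .SE => -1
  | .S => -1
  | .E => 0

/-- Height (`y`-coordinate) after performing the steps of `l`, starting at height `h`. -/
def pathHeight (h : ℕ) (l : List PStep) : ℤ := (h : ℤ) + (l.map stepDy).sum

/-- `x`-coordinate after performing the steps of `l`, starting on the `y`-axis. -/
def pathX (l : List PStep) : ℕ := (l.map stepDx).sum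

/-- A valid path: stays in the first quadrant, starts at `(0,h)` on the `y`-axis, ends
on the `x`-axis, South steps only appear directly after a North-East step, East steps
only appear at height `0`, and the path is empty or ends with a South-East or South step. -/
def ValidPath (h : ℕ) (l : List PStep) : Prop :=
  (∀ m : ℕ, 0 ≤ pathHeight h (l.take m)) ∧
  (∀ m : ℕ, l[m]? = some PStep.S → ∃ m', m = m' + 1 ∧ l[m']? = some PStep.NE) ∧
  (∀ m : ℕ, l[m]? = some PStep.E → pathHeight h (l.take m) = 0) ∧
  pathHeight h l = 0 ∧
  (l = [] ∨ l.getLast? = some PStep.SE ∨ l.getLast? = some PStep.S)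

/-- The vertex reached after step `m` is a peak: it is preceded by a North-East step and
followed by a South-East step (NESE peak) or a South step (NES peak). -/
def IsPeak (l : List PStep) (m : ℕ) : Prop :=
  l[m]? = some PStep.NE ∧ (l[m+1]? = some PStep.SE ∨ l[m+1]? = some PStep.S)

instance (l : List PStep) (m : ℕ) : Decidable (IsPeak l m) := by
  unfold IsPeak; infer_instance

/-- The major index of a path: the sum of the `x`-coordinates of its peaks. -/
def majorIndex (l : List PStep) : ℕ :=
  ∑ m ∈ Finset.range l.length, if IsPeak l m then pathX (l.take (m + 1)) else 0

/-- The number of peaks of a path. -/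
def numPeaks (l : List PStep) : ℕ :=
  ((Finset.range l.length).filter fun m => IsPeak l m).card

/-- The number of South steps of a path. -/
def southSteps (l : List PStep) : ℕ := l.count PStep.S

/-- A path satisfies the special `(k,i)`-conditions if it is a valid path starting at
height `k - i` whose height always stays below `k`. -/
def SpecialPath (k i : ℕ) (l : List PStep) : Prop :=
  ValidPath (k - i) l ∧ ∀ m : ℕ, pathHeight (k - i) (l.take m) < k

/-- `Ebar k i n j` is the number of paths with major index `n` and `j` South steps
satisfying the special `(k,i)`-conditions. -/
noncomputable def Ebar (k i n j : ℕ) : ℕ :=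
  Nat.card {l : List PStep // SpecialPath k i l ∧ majorIndex l = n ∧ southSteps l = j}


/-- An overpartition is represented as a list of pairs `(part, overlined?)`.
Parts are positive, the list is non-increasing in the part sizes, and among
equal parts only the final occurrence may be overlined. -/
def IsOverpartition (l : List (ℕ × Bool)) : Prop :=
  (∀ p ∈ l, 1 ≤ p.1) ∧
  l.Chain' fun x y => y.1 < x.1 ∨ (x.1 = y.1 ∧ x.2 = false)

/-- The weight of an overpartition: the sum of its parts. -/
def opWeight (l : List (ℕ × Bool)) : ℕ := (l.map Prod.fst).sum

/-- The number of overlined parts. -/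
def opOverlined (l : List (ℕ × Bool)) : ℕ := (l.filter fun p => p.2).length

/-- The difference condition of Gordon type: `λ_ℓ - λ_{ℓ+k-1} ≥ 1` if `λ_{ℓ+k-1}` is
overlined and `λ_ℓ - λ_{ℓ+k-1} ≥ 2` otherwise (indices `0`-based). -/
def GapCond (k : ℕ) (l : List (ℕ × Bool)) : Prop :=
  ∀ m : ℕ, m + (k - 1) < l.length →
    (l.getD (m + (k - 1)) (0, false)).1 +
      (if (l.getD (m + (k - 1)) (0, false)).2 then 1 else 2) ≤ (l.getD m (0, false)).1

/-- Overpartitions counted by `B̄_{k,i}`: the Gordon difference condition holds and at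
most `i - 1` parts are equal to `1`. -/
def BCond (k i : ℕ) (l : List (ℕ × Bool)) : Prop :=
  IsOverpartition l ∧ GapCond k l ∧ (l.filter fun p => p.1 == 1).length ≤ i - 1

/-- `Bbar k i n j` : the number of overpartitions of `n` with `j` overlined parts
satisfying the `B̄_{k,i}` conditions. -/
noncomputable def Bbar (k i n j : ℕ) : ℕ :=
  Nat.card {l : List (ℕ × Bool) //
    BCond k i l ∧ opWeight l = n ∧ opOverlined l = j}

/-- The Frobenius representation of an overpartition: a two-rowed array whose top row
is a partition into distinct nonnegative parts and whose bottom row is an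
overpartition into nonnegative parts where the first occurrence of a part may be
overlined. -/
structure FrobSym : Type where
  top : List ℕ
  bot : List (ℕ × Bool)
  top_sorted : top.Chain' (· > ·)
  bot_sorted : bot.Chain' fun x y => y.1 < x.1 ∨ (x.1 = y.1 ∧ y.2 = false)
  len_eq : top.length = bot.length

/-- The number of columns of a Frobenius symbol. -/
def frobCols (F : FrobSym) : ℕ := F.top.length

/-- The weight of the overpartition represented by a Frobenius symbol. -/
def frobWeight (F : FrobSym) : ℕ :=
  F.top.length + F.top.sum + (F.bot.map Prod.fst).sum

/-- The number of non-overlined parts in the bottom row. -/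
def botNonOverlined (F : FrobSym) : ℕ := (F.bot.filter fun p => !p.2).length

/-- The number of overlined parts in the bottom row. -/
def botOverlined (F : FrobSym) : ℕ := (F.bot.filter fun p => p.2).length

/-- The `m`-th successive rank (0-based): `a_m - b_m` minus the number of
non-overlined parts among `b_{m+1}, …, b_N`. -/
def frobRank (F : FrobSym) (m : ℕ) : ℤ :=
  (F.top.getD m 0 : ℤ) - ((F.bot.getD m (0, false)).1 : ℤ) -
    (((F.bot.drop (m + 1)).filter fun p => !p.2).length : ℤ)

/-- All successive ranks lie in the interval `[-i+2, 2k-i-1]`. -/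
def RankCond (k i : ℕ) (F : FrobSym) : Prop :=
  ∀ m : ℕ, m < F.top.length →
    -(i : ℤ) + 2 ≤ frobRank F m ∧ frobRank F m ≤ 2 * (k : ℤ) - i - 1

/-- `Cbar k i n j` : the number of overpartitions of `n` (counted through their
Frobenius representation) with `j` non-overlined parts in the bottom row and all
successive ranks in `[-i+2, 2k-i-1]`. -/
noncomputable def Cbar (k i n j : ℕ) : ℕ :=
  Nat.card {F : FrobSym //
    frobWeight F = n ∧ botNonOverlined F = j ∧ RankCond k i F}

/-- The list of overlined parts (in order). -/
def olList (l : List (ℕ × Bool)) : List ℕ := (l.filter fun p => p.2).map Prod.fst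

/-- The list of non-overlined parts (in order). -/
def nolList (l : List (ℕ × Bool)) : List ℕ := (l.filter fun p => !p.2).map Prod.fst

/-- The size of the generalized Durfee square: the largest `N` such that the number of
overlined parts plus the number of non-overlined parts `≥ N` is at least `N`. -/
noncomputable def genDurfeeSize (l : List (ℕ × Bool)) : ℕ :=
  Nat.findGreatest
    (fun N => N ≤ (olList l).length + ((nolList l).filter fun p => decide (N ≤ p)).length)
    l.length

/-- The size of the generalized Durfee rectangle: the largest `N` such that the number
of overlined parts plus the number of non-overlined parts `≥ N + 1` is at least `N`. -/
noncomputable def genDurfeeRectSize (l : List (ℕ × Bool)) : ℕ :=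
  Nat.findGreatest
    (fun N => N ≤ (olList l).length + ((nolList l).filter fun p => decide (N + 1 ≤ p)).length)
    l.length

/-- The (ordinary) partition lying below the first generalized Durfee square/rectangle
of size `N`, when the overlined parts are displayed above the non-overlined ones. -/
def belowGen (l : List (ℕ × Bool)) (N : ℕ) : List ℕ :=
  (nolList l).drop (N - (olList l).length)

/-- The size of the Durfee square of an ordinary partition. -/
noncomputable def durfeeSquareSize (μ : List ℕ) : ℕ :=
  Nat.findGreatest (fun d => d ≤ (μ.filter fun p => decide (d ≤ p)).length) μ.length

/-- The size of the `d × (d+1)` Durfee rectangle of an ordinary partition. -/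
noncomputable def durfeeRectSize (μ : List ℕ) : ℕ :=
  Nat.findGreatest (fun d => d ≤ (μ.filter fun p => decide (d + 1 ≤ p)).length) μ.length

/-- Remove `m` successive Durfee squares. -/
noncomputable def dissectSquares : ℕ → List ℕ → List ℕ
  | 0, μ => μ
  | m + 1, μ => dissectSquares m (μ.drop (durfeeSquareSize μ))

/-- Remove `m` successive Durfee rectangles. -/
noncomputable def dissectRects : ℕ → List ℕ → List ℕ
  | 0, μ => μ
  | m + 1, μ => dissectRects m (μ.drop (durfeeRectSize μ))

/-- The overpartition has `i - 1` successive Durfee squares followed by `k - i`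
successive Durfee rectangles, the first one being a generalized
Durfee square (if `i ≥ 2`) or a generalized Durfee rectangle (if `i = 1`). -/
noncomputable def DurfeeCond (k i : ℕ) (l : List (ℕ × Bool)) : Prop :=
  if 2 ≤ i then
    dissectRects (k - i) (dissectSquares (i - 2) (belowGen l (genDurfeeSize l))) = []
  else
    dissectRects (k - 2) (belowGen l (genDurfeeRectSize l)) = []

/-- `Dbar k i n j` : the number of overpartitions of `n` with `j` overlined parts and
`i-1` successive Durfee squares followed by `k-i` successive Durfee rectangles, the
first one being a generalized Durfee square/rectangle. -/
noncomputable def Dbar (k i n j : ℕ) : ℕ :=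
  Nat.card {l : List (ℕ × Bool) //
    IsOverpartition l ∧ opWeight l = n ∧ opOverlined l = j ∧ DurfeeCond k i l}


/-- The down step following a peak: South-East for an overlined part, South otherwise. -/
def downStep (t : Bool) : PStep := if t then .SE else .S

/-- Recursive form of the special conditions for the end of a path: `prev` is the step just
performed and `h` the current height. -/
def SuffixOk (k : ℕ) : PStep → ℕ → List PStep → Prop
  | prev, h, [] => h = 0 ∧ (prev = .SE ∨ prev = .S)
  | _, h, .NE :: l => h + 1 < k ∧ SuffixOk k .NE (h + 1) l
  | _, h, .SE :: l => 1 ≤ h ∧ SuffixOk k .SE (h - 1) l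
  | prev, h, .S :: l => prev = .NE ∧ 1 ≤ h ∧ SuffixOk k .S (h - 1) l
  | _, h, .E :: l => h = 0 ∧ SuffixOk k .E 0 l

theorem pathHeight_cons (h : ℕ) (s : PStep) (l : List PStep) :
    pathHeight h (s :: l) = h + stepDy s + (l.map stepDy).sum := by
  simp [pathHeight]; ring

theorem suffixOk_iff (k : ℕ) (l : List PStep) : ∀ (prev : PStep) (h : ℕ), h < k →
    (((∀ m : ℕ, 0 ≤ pathHeight h (l.take m)) ∧
      (∀ m : ℕ, l[m]? = some PStep.S →
        (m = 0 ∧ prev = .NE) ∨ ∃ m', m = m' + 1 ∧ l[m']? = some PStep.NE) ∧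
      (∀ m : ℕ, l[m]? = some PStep.E → pathHeight h (l.take m) = 0) ∧
      pathHeight h l = 0 ∧
      ((l = [] ∧ (prev = .SE ∨ prev = .S)) ∨
        l.getLast? = some PStep.SE ∨ l.getLast? = some PStep.S) ∧
      ∀ m : ℕ, pathHeight h (l.take m) < k) ↔ SuffixOk k prev h l) := by
  induction l with
  | nil =>
    intro prev h hk
    simp [SuffixOk, pathHeight]
    omega
  | cons s l ih =>
    intro prev h hk
    have getLast_iff :
        (((s :: l = [] ∧ (prev = .SE ∨ prev = .S)) ∨ (s :: l).getLast? = some PStep.SE ∨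
          (s :: l).getLast? = some PStep.S) ↔
        ((l = [] ∧ (s = .SE ∨ s = .S)) ∨ l.getLast? = some PStep.SE ∨
          l.getLast? = some PStep.S)) := by
      cases l <;> simp
    rw [getLast_iff]
    have south_iff : (∀ m : ℕ, (s :: l)[m]? = some PStep.S →
          (m = 0 ∧ prev = .NE) ∨ ∃ m', m = m' + 1 ∧ (s :: l)[m']? = some PStep.NE) ↔
        (s = .S → prev = .NE) ∧ (∀ m : ℕ, l[m]? = some PStep.S →
          (m = 0 ∧ s = .NE) ∨ ∃ m', m = m' + 1 ∧ l[m']? = some PStep.NE) := by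
      rw [← Nat.and_forall_add_one]
      refine and_congr (by simp) (forall_congr' fun m => ?_)
      cases m <;> simp
    rw [south_iff]
    rw [← Nat.and_forall_add_one, ← Nat.and_forall_add_one (p := fun m =>
      (s :: l)[m]? = some PStep.E → _), ← Nat.and_forall_add_one (p := fun m =>
      pathHeight h (List.take m (s :: l)) < k)]
    have nonneg_and {h' : ℤ} (h0 : ∀ m : ℕ, 0 ≤ h' + ((l.take m).map stepDy).sum) : 0 ≤ h' := by
      simpa using h0 0
    have lt_and {h' : ℤ} (h0 : ∀ m : ℕ, h' + ((l.take m).map stepDy).sum < k) : h' < k := by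
      simpa using h0 0
    simp only [List.take_succ_cons, pathHeight_cons, List.getElem?_cons_succ, List.take_zero,
      List.getElem?_cons_zero, Option.some.injEq]
    cases s with
    | NE =>
      simp only [SuffixOk, stepDy]
      constructor
      · rintro ⟨⟨-, h1⟩, ⟨-, h2⟩, ⟨-, h3⟩, h4, h5, -, h6⟩
        have := lt_and h6
        have hk' : h + 1 < k := by omega
        refine ⟨hk', (ih .NE (h + 1) hk').1 ?_⟩
        simp only [pathHeight, Nat.cast_add, Nat.cast_one]
        exact ⟨h1, h2, h3, h4, h5, h6⟩
      · rintro ⟨hk', hl⟩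
        have := (ih .NE (h + 1) hk').2 hl
        simp only [pathHeight, Nat.cast_add, Nat.cast_one] at this
        obtain ⟨h1, h2, h3, h4, h5, h6⟩ := this
        exact ⟨⟨by simp [pathHeight], h1⟩, ⟨by simp, h2⟩, ⟨by simp, h3⟩, h4, h5,
          by simpa [pathHeight] using hk, h6⟩
    | SE =>
      simp only [SuffixOk, stepDy]
      constructor
      · rintro ⟨⟨-, h1⟩, ⟨-, h2⟩, ⟨-, h3⟩, h4, h5, -, h6⟩
        have := nonneg_and h1
        have hk' : 1 ≤ h := by omega
        refine ⟨hk', (ih .SE (h - 1) (by omega)).1 ?_⟩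
        simp only [pathHeight, Nat.cast_sub hk', Nat.cast_one]
        exact ⟨h1, h2, h3, h4, h5, h6⟩
      · rintro ⟨hk', hl⟩
        have := (ih .SE (h - 1) (by omega)).2 hl
        simp only [pathHeight, Nat.cast_sub hk', Nat.cast_one] at this
        obtain ⟨h1, h2, h3, h4, h5, h6⟩ := this
        exact ⟨⟨by simp [pathHeight], h1⟩, ⟨by simp, h2⟩, ⟨by simp, h3⟩, h4, h5,
          by simpa [pathHeight] using hk, h6⟩
    | S =>
      simp only [SuffixOk, stepDy]
      constructor
      · rintro ⟨⟨-, h1⟩, ⟨h0, h2⟩, ⟨-, h3⟩, h4, h5, -, h6⟩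
        have := nonneg_and h1
        have hk' : 1 ≤ h := by omega
        refine ⟨h0 trivial, hk', (ih .S (h - 1) (by omega)).1 ?_⟩
        simp only [pathHeight, Nat.cast_sub hk', Nat.cast_one]
        exact ⟨h1, h2, h3, h4, h5, h6⟩
      · rintro ⟨h0, hk', hl⟩
        have := (ih .S (h - 1) (by omega)).2 hl
        simp only [pathHeight, Nat.cast_sub hk', Nat.cast_one] at this
        obtain ⟨h1, h2, h3, h4, h5, h6⟩ := this
        exact ⟨⟨by simp [pathHeight], h1⟩, ⟨fun _ => h0, h2⟩, ⟨by simp, h3⟩, h4, h5,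
          by simpa [pathHeight] using hk, h6⟩
    | E =>
      simp only [SuffixOk, stepDy]
      constructor
      · rintro ⟨⟨-, h1⟩, ⟨-, h2⟩, ⟨h0, h3⟩, h4, h5, -, h6⟩
        have hk' : h = 0 := by simpa [pathHeight] using h0 trivial
        subst hk'
        refine ⟨rfl, (ih .E 0 hk).1 ?_⟩
        simp only [pathHeight]
        exact ⟨by simpa using h1, h2, by simpa using h3, by simpa using h4, h5, by simpa using h6⟩
      · rintro ⟨rfl, hl⟩
        have := (ih .E 0 hk).2 hl
        simp only [pathHeight] at this
        obtain ⟨h1, h2, h3, h4, h5, h6⟩ := this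
        exact ⟨⟨by simp [pathHeight], by simpa using h1⟩, ⟨by simp, h2⟩,
          ⟨by simp [pathHeight], by simpa using h3⟩, by simpa using h4, h5,
          by simpa [pathHeight] using hk, by simpa using h6⟩

theorem specialPath_iff {k i : ℕ} (hi : 1 ≤ i) (hik : i ≤ k) (l : List PStep) :
    SpecialPath k i l ↔ SuffixOk k .SE (k - i) l := by
  rw [← suffixOk_iff k l .SE (k - i) (by omega)]
  simp [SpecialPath, ValidPath, and_assoc]

/-- The sum of the `x`-coordinates of the peaks of `l` when `l` starts at abscissa `X`. -/
def majorFrom (X : ℕ) (l : List PStep) : ℕ :=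
  ∑ m ∈ Finset.range l.length, if IsPeak l m then X + pathX (l.take (m + 1)) else 0

theorem majorFrom_zero (l : List PStep) : majorFrom 0 l = majorIndex l := by
  simp [majorFrom, majorIndex]

theorem isPeak_cons_succ (s : PStep) (l : List PStep) (m : ℕ) :
    IsPeak (s :: l) (m + 1) ↔ IsPeak l m := by
  simp [IsPeak]

theorem majorFrom_cons (X : ℕ) (s : PStep) (l : List PStep) :
    majorFrom X (s :: l) =
      (if IsPeak (s :: l) 0 then X + stepDx s else 0) + majorFrom (X + stepDx s) l := by
  simp [majorFrom, Finset.sum_range_succ', isPeak_cons_succ, pathX, add_comm, add_left_comm]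

theorem numPeaks_cons (s : PStep) (l : List PStep) :
    numPeaks (s :: l) = (if IsPeak (s :: l) 0 then 1 else 0) + numPeaks l := by
  simp only [numPeaks, Finset.card_filter, List.length_cons, Finset.sum_range_succ',
    isPeak_cons_succ, add_comm]

theorem not_isPeak_zero_of_ne {s : PStep} (hs : s ≠ .NE) (l : List PStep) :
    ¬ IsPeak (s :: l) 0 := by
  simp [IsPeak, hs]

theorem isPeak_zero_downStep (t : Bool) (l : List PStep) :
    IsPeak (.NE :: downStep t :: l) 0 := by
  cases t <;> simp [IsPeak, downStep]

theorem not_isPeak_zero_rise (l : List PStep) : ¬ IsPeak (.NE :: .NE :: l) 0 := by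
  simp [IsPeak]

theorem downStep_ne (t : Bool) : downStep t ≠ .NE := by
  cases t <;> simp [downStep]

theorem majorFrom_replicate {s : PStep} (hs : s ≠ .NE) (hx : stepDx s = 1) (X d : ℕ)
    (l : List PStep) :
    majorFrom X (List.replicate d s ++ l) = majorFrom (X + d) l := by
  induction d generalizing X with
  | zero => simp
  | succ d ih =>
    rw [List.replicate_succ, List.cons_append, majorFrom_cons,
      if_neg (not_isPeak_zero_of_ne hs _), ih, hx, zero_add]
    congr 1; ring

theorem numPeaks_replicate {s : PStep} (hs : s ≠ .NE) (d : ℕ) (l : List PStep) :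
    numPeaks (List.replicate d s ++ l) = numPeaks l := by
  induction d with
  | zero => simp
  | succ d ih =>
    rw [List.replicate_succ, List.cons_append, numPeaks_cons,
      if_neg (not_isPeak_zero_of_ne hs _), ih, zero_add]

theorem majorFrom_rise (X d : ℕ) (t : Bool) (l : List PStep) :
    majorFrom X (List.replicate (d + 1) .NE ++ downStep t :: l) =
      X + (d + 1) + majorFrom (X + (d + 1) + stepDx (downStep t)) l := by
  induction d generalizing X with
  | zero =>
    rw [List.replicate_one, List.singleton_append, majorFrom_cons,
      if_pos (isPeak_zero_downStep t l), majorFrom_cons,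
      if_neg (not_isPeak_zero_of_ne (downStep_ne t) _)]
    simp [stepDx]
  | succ d ih =>
    rw [List.replicate_succ, List.cons_append, majorFrom_cons, ih, if_neg]
    · simp only [stepDx, zero_add]
      rw [show X + 1 + (d + 1) = X + (d + 1 + 1) by ring]
    · rw [List.replicate_succ, List.cons_append]
      exact not_isPeak_zero_rise _

theorem numPeaks_rise (d : ℕ) (t : Bool) (l : List PStep) :
    numPeaks (List.replicate (d + 1) .NE ++ downStep t :: l) = 1 + numPeaks l := by
  induction d with
  | zero =>
    rw [List.replicate_one, List.singleton_append, numPeaks_cons,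
      if_pos (isPeak_zero_downStep t l), numPeaks_cons,
      if_neg (not_isPeak_zero_of_ne (downStep_ne t) _), zero_add]
  | succ d ih =>
    rw [List.replicate_succ, List.cons_append, numPeaks_cons, ih, if_neg, zero_add]
    rw [List.replicate_succ, List.cons_append]
    exact not_isPeak_zero_rise _

/-- The height of the peak attached to the column `(A, B)`. -/
def peakHeight (h A B : ℕ) : ℕ := if h + B < A then A - B - h else 1 + h + B - A

/-- The number of South-East steps strictly between the down step after the peak `(A, B)` and
the next valley, when the next peak is `(A', B')`. -/
def descent (h A B A' B' : ℕ) : ℕ :=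
  if peakHeight h A B + peakHeight h A' B' ≤ (A' - A) + (B' - B) then peakHeight h A B - 1
  else if h + B < A then B' - B - 1 else A' - A - 1

/-- The number of East steps between the peaks `(A, B)` and `(A', B')`. -/
def plateau (h A B A' B' : ℕ) : ℕ :=
  (A' - A) + (B' - B) - (peakHeight h A B + peakHeight h A' B')

/-- The number of North-East steps between the peaks `(A, B)` and `(A', B')`. -/
def ascent (h A B A' B' : ℕ) : ℕ :=
  if peakHeight h A B + peakHeight h A' B' ≤ (A' - A) + (B' - B) then peakHeight h A' B'
  else if h + B < A then A' - A else B' - B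

theorem peakHeight_pos (h A B : ℕ) : 1 ≤ peakHeight h A B := by
  unfold peakHeight; split_ifs <;> omega

theorem segment_spec {h A B A' B' : ℕ} (hA : A < A') (hB : B < B') :
    descent h A B A' B' + 1 ≤ peakHeight h A B ∧
    descent h A B A' B' + 1 + plateau h A B A' B' + ascent h A B A' B' = A' - A + (B' - B) ∧
    peakHeight h A' B' + descent h A B A' B' + 1 = peakHeight h A B + ascent h A B A' B' ∧
    (0 < plateau h A B A' B' → descent h A B A' B' + 1 = peakHeight h A B) ∧
    1 ≤ ascent h A B A' B' := by
  unfold descent plateau ascent peakHeight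
  split_ifs <;> omega

theorem segment_injective {h A B A' B' A'' B'' : ℕ} (hA : A < A') (hB : B < B')
    (hA' : A < A'') (hB' : B < B'')
    (hd : descent h A B A' B' = descent h A B A'' B'')
    (hp : plateau h A B A' B' = plateau h A B A'' B'')
    (ha : ascent h A B A' B' = ascent h A B A'' B'') : A' = A'' ∧ B' = B'' := by
  unfold descent plateau ascent peakHeight at *
  split_ifs at * <;> omega

theorem segment_surjective {h A B d e u : ℕ} (hd : d + 1 ≤ peakHeight h A B)
    (he : 0 < e → d + 1 = peakHeight h A B) (hu : 1 ≤ u) :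
    ∃ A' B', A < A' ∧ B < B' ∧ descent h A B A' B' = d ∧ plateau h A B A' B' = e ∧
      ascent h A B A' B' = u := by
  unfold descent plateau ascent
  unfold peakHeight at *
  by_cases hs : h + B < A
  · by_cases hp : e % 2 = 0
    · refine ⟨A + u + e / 2, B + d + 1 + e / 2, by omega, by omega, ?_⟩
      split_ifs at * <;> omega
    · refine ⟨A + e / 2 + 1, B + u + d + 1 + e / 2, by omega, by omega, ?_⟩
      split_ifs at * <;> omega
  · by_cases hp : e % 2 = 0
    · refine ⟨A + d + 1 + e / 2, B + u + e / 2, by omega, by omega, ?_⟩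
      split_ifs at * <;> omega
    · refine ⟨A + d + u + 1 + e / 2, B + e / 2 + 1, by omega, by omega, ?_⟩
      split_ifs at * <;> omega

/-- The part of the path following the down step of the peak `(A, B)`, where `L` lists the
columns of the peaks still to come, from left to right. -/
def buildPath (h : ℕ) : ℕ → ℕ → List (ℕ × ℕ × Bool) → List PStep
  | A, B, [] => List.replicate (peakHeight h A B - 1) .SE
  | A, B, (A', B', t) :: L =>
    List.replicate (descent h A B A' B') .SE ++ (List.replicate (plateau h A B A' B') .E ++
      (List.replicate (ascent h A B A' B') .NE ++ downStep t :: buildPath h A' B' L))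

/-- The columns of `L` increase strictly in both coordinates, starting after `(A, B)`, and their
peaks have height less than `k`. -/
def ColumnsOk (k h : ℕ) : ℕ → ℕ → List (ℕ × ℕ × Bool) → Prop
  | _, _, [] => True
  | A, B, (A', B', _) :: L =>
    A < A' ∧ B < B' ∧ peakHeight h A' B' < k ∧ ColumnsOk k h A' B' L

/-- The number of columns marked as non-overlined. -/
def plainCount (L : List (ℕ × ℕ × Bool)) : ℕ := L.countP fun c => !c.2.2

/-- The sum of the abscissas of the peaks of the columns of `L`, when `u` South steps precede
them. -/
def columnsWeight : ℕ → List (ℕ × ℕ × Bool) → ℤ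
  | _, [] => 0
  | u, (A, B, t) :: L =>
    ((A : ℤ) + B - 1 - u) + columnsWeight (u + if t then 0 else 1) L

theorem suffixOk_replicate_SE {k : ℕ} {prev : PStep} (hp : prev = .SE ∨ prev = .S) {d h : ℕ}
    (hd : d ≤ h) (l : List PStep)
    (hl : ∀ prev' : PStep, prev' = .SE ∨ prev' = .S → SuffixOk k prev' (h - d) l) :
    SuffixOk k prev h (List.replicate d .SE ++ l) := by
  induction d generalizing prev h with
  | zero => exact hl prev hp
  | succ d ih =>
    refine ⟨by omega, ih (Or.inl rfl) (by omega) fun p hp' => ?_⟩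
    rw [show h - 1 - d = h - (d + 1) by omega]
    exact hl p hp'

theorem suffixOk_replicate_E {k : ℕ} (prev : PStep) (e : ℕ) (l : List PStep)
    (hl : ∀ prev' : PStep, SuffixOk k prev' 0 l) :
    SuffixOk k prev 0 (List.replicate e .E ++ l) := by
  induction e generalizing prev with
  | zero => exact hl prev
  | succ e ih => exact ⟨rfl, ih _⟩

theorem suffixOk_rise {k : ℕ} (prev : PStep) {u h : ℕ} (hu : h + (u + 1) < k) (t : Bool)
    (l : List PStep) (hl : SuffixOk k (downStep t) (h + u) l) :
    SuffixOk k prev h (List.replicate (u + 1) .NE ++ downStep t :: l) := by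
  induction u generalizing prev h with
  | zero =>
    refine ⟨by omega, ?_⟩
    cases t
    · exact ⟨rfl, by omega, hl⟩
    · exact ⟨by omega, hl⟩
  | succ u ih =>
    refine ⟨by omega, ih .NE (by omega) ?_⟩
    rwa [show h + 1 + u = h + (u + 1) by ring]

theorem downStep_eq (t : Bool) : downStep t = .SE ∨ downStep t = .S := by
  cases t <;> simp [downStep]

theorem suffixOk_buildPath {k h : ℕ} (L : List (ℕ × ℕ × Bool)) : ∀ (A B : ℕ) (prev : PStep),
    prev = .SE ∨ prev = .S → ColumnsOk k h A B L →
    SuffixOk k prev (peakHeight h A B - 1) (buildPath h A B L) := by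
  induction L with
  | nil =>
    intro A B prev hp _
    have := suffixOk_replicate_SE (k := k) hp (le_refl (peakHeight h A B - 1)) []
      (fun p hp' => by simpa [SuffixOk] using hp')
    simpa [buildPath] using this
  | cons c L ih =>
    obtain ⟨A', B', t⟩ := c
    rintro A B prev hp ⟨hA, hB, hk, hL⟩
    obtain ⟨h1, -, h3, h4, h5⟩ := segment_spec (h := h) hA hB
    have hrise : ∀ prev' : PStep,
        SuffixOk k prev' (peakHeight h A B - 1 - descent h A B A' B')
          (List.replicate (ascent h A B A' B') .NE ++ downStep t :: buildPath h A' B' L) := by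
      intro prev'
      obtain ⟨u, hu⟩ : ∃ u, ascent h A B A' B' = u + 1 := ⟨_, (Nat.sub_add_cancel h5).symm⟩
      rw [hu]
      refine suffixOk_rise prev' (by omega) t _ ?_
      have := ih A' B' (downStep t) (downStep_eq t) hL
      rwa [show peakHeight h A B - 1 - descent h A B A' B' + u = peakHeight h A' B' - 1 by omega]
    refine suffixOk_replicate_SE hp (by omega) _ fun p _ => ?_
    rcases Nat.eq_zero_or_pos (plateau h A B A' B') with he | he
    · rw [he]
      exact hrise p
    · have h0 : peakHeight h A B - 1 - descent h A B A' B' = 0 := by have := h4 he; omega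
      rw [h0] at hrise ⊢
      exact suffixOk_replicate_E p _ _ hrise

instance : LawfulBEq PStep where
  eq_of_beq {a b} := by cases a <;> cases b <;> decide
  rfl {a} := by cases a <;> rfl

theorem southSteps_buildPath (h : ℕ) (L : List (ℕ × ℕ × Bool)) (A B : ℕ) :
    southSteps (buildPath h A B L) = plainCount L := by
  induction L generalizing A B with
  | nil => simp [buildPath, southSteps, plainCount, List.count_replicate]
  | cons c L ih =>
    obtain ⟨A', B', t⟩ := c
    have := ih A' B'
    simp only [southSteps, plainCount] at this ⊢
    cases t <;> simp [buildPath, List.count_replicate, downStep, this]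

theorem numPeaks_buildPath {k h : ℕ} (L : List (ℕ × ℕ × Bool)) (A B : ℕ)
    (hL : ColumnsOk k h A B L) : numPeaks (buildPath h A B L) = L.length := by
  induction L generalizing A B with
  | nil =>
    have := numPeaks_replicate (s := .SE) (by simp) (peakHeight h A B - 1) []
    simpa [buildPath, numPeaks] using this
  | cons c L ih =>
    obtain ⟨A', B', t⟩ := c
    obtain ⟨hA, hB, -, hL⟩ := hL
    obtain ⟨-, -, -, -, h5⟩ := segment_spec (h := h) hA hB
    rw [buildPath, numPeaks_replicate (by simp), numPeaks_replicate (by simp),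
      ← Nat.sub_add_cancel h5, numPeaks_rise, ih A' B' hL, List.length_cons, add_comm]

theorem majorFrom_buildPath {k h : ℕ} (L : List (ℕ × ℕ × Bool)) (A B u X : ℕ)
    (hL : ColumnsOk k h A B L) (hX : X + u = A + B) :
    (majorFrom X (buildPath h A B L) : ℤ) = columnsWeight u L := by
  induction L generalizing A B u X with
  | nil =>
    have := majorFrom_replicate (s := .SE) (by simp) rfl X (peakHeight h A B - 1) []
    rw [List.append_nil] at this
    rw [buildPath, this]
    simp [majorFrom, columnsWeight]
  | cons c L ih =>
    obtain ⟨A', B', t⟩ := c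
    obtain ⟨hA, hB, -, hL⟩ := hL
    obtain ⟨-, h2, -, -, h5⟩ := segment_spec (h := h) hA hB
    rw [buildPath, majorFrom_replicate (by simp) rfl, majorFrom_replicate (by simp) rfl,
      ← Nat.sub_add_cancel h5, majorFrom_rise, columnsWeight, Nat.cast_add,
      ih A' B' (u + if t then 0 else 1) _ hL]
    · push_cast
      omega
    · cases t <;> simp [downStep, stepDx] <;> omega

theorem replicate_append_inj {α : Type*} {a : α} {n m : ℕ} {l l' : List α}
    (hl : l.head? ≠ some a) (hl' : l'.head? ≠ some a)
    (heq : List.replicate n a ++ l = List.replicate m a ++ l') : n = m ∧ l = l' := by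
  induction n generalizing m with
  | zero =>
    cases m with
    | zero => exact ⟨rfl, by simpa using heq⟩
    | succ m => simp [List.replicate_succ] at heq; simp [heq] at hl
  | succ n ih =>
    cases m with
    | zero => simp [List.replicate_succ] at heq; simp [← heq] at hl'
    | succ m =>
      simp only [List.replicate_succ, List.cons_append, List.cons.injEq, true_and] at heq
      obtain ⟨rfl, h⟩ := ih heq
      exact ⟨rfl, h⟩

theorem buildPath_injective {k h : ℕ} (L : List (ℕ × ℕ × Bool)) : ∀ (L' : List (ℕ × ℕ × Bool))
    (A B : ℕ), ColumnsOk k h A B L → ColumnsOk k h A B L' →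
    buildPath h A B L = buildPath h A B L' → L = L' := by
  have peak_mem (A B A' B' : ℕ) (hA : A < A') (hB : B < B') (t : Bool) (L) :
      PStep.NE ∈ buildPath h A B ((A', B', t) :: L) := by
    obtain ⟨-, -, -, -, h5⟩ := segment_spec (h := h) hA hB
    simp [buildPath]
    omega
  have ne_mem_nil (A B : ℕ) : PStep.NE ∉ buildPath h A B [] := by
    simp [buildPath]
  induction L with
  | nil =>
    rintro (_ | ⟨⟨A', B', t⟩, L'⟩) A B - hL' heq
    · rfl
    · exact absurd (heq ▸ peak_mem A B A' B' hL'.1 hL'.2.1 t L') (ne_mem_nil A B)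
  | cons c L ih =>
    obtain ⟨A', B', t⟩ := c
    rintro (_ | ⟨⟨A'', B'', t'⟩, L'⟩) A B ⟨hA, hB, -, hL⟩ hL' heq
    · exact absurd (heq ▸ peak_mem A B A' B' hA hB t L) (ne_mem_nil A B)
    · obtain ⟨hA', hB', -, hL'⟩ := hL'
      obtain ⟨-, -, -, -, h5⟩ := segment_spec (h := h) hA hB
      obtain ⟨-, -, -, -, h5'⟩ := segment_spec (h := h) hA' hB'
      simp only [buildPath] at heq
      have head_rise (u : ℕ) (hu : 1 ≤ u) (l : List PStep) :
          (List.replicate u PStep.NE ++ l).head? = some PStep.NE := by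
        obtain ⟨u, rfl⟩ := Nat.exists_eq_add_of_le' hu
        simp [List.replicate_succ]
      have head_plateau (e u : ℕ) (hu : 1 ≤ u) (l : List PStep) :
          (List.replicate e PStep.E ++ (List.replicate u PStep.NE ++ l)).head? ≠
            some PStep.SE := by
        cases e with
        | zero => rw [List.replicate_zero, List.nil_append, head_rise u hu]; simp
        | succ e => simp [List.replicate_succ]
      have head_down (t : Bool) (l : List PStep) : (downStep t :: l).head? ≠ some PStep.NE := by
        simpa using downStep_ne t
      obtain ⟨hd, heq⟩ := replicate_append_inj (head_plateau _ _ h5 _) (head_plateau _ _ h5' _) heq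
      obtain ⟨hp, heq⟩ := replicate_append_inj (by rw [head_rise _ h5]; simp)
        (by rw [head_rise _ h5']; simp) heq
      obtain ⟨ha, heq⟩ := replicate_append_inj (head_down _ _) (head_down _ _) heq
      obtain ⟨rfl, rfl⟩ := segment_injective hA hB hA' hB' hd hp ha
      simp only [List.cons.injEq] at heq
      have ht : t = t' := by
        have := heq.1
        cases t <;> cases t' <;> simp_all [downStep]
      rw [ht, ih L' A' B' hL hL' heq.2]

theorem suffixOk_decompose {k : ℕ} (l : List PStep) : ∀ (prev : PStep) (h : ℕ), h < k →
    (prev = .NE → 1 ≤ h) → (prev = .E → h = 0) → SuffixOk k prev h l →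
    (l = List.replicate h .SE ∧ (prev = .SE ∨ prev = .S)) ∨
    ∃ (d e u : ℕ) (t : Bool) (l' : List PStep),
      l = List.replicate d .SE ++ (List.replicate e .E ++
        (List.replicate u .NE ++ downStep t :: l')) ∧
      d ≤ h ∧ (0 < e → d = h) ∧ (0 < d → prev = .SE ∨ prev = .S) ∧ (0 < e → prev ≠ .NE) ∧
      (u = 0 → prev = .NE) ∧ h - d + u < k ∧ 1 ≤ h - d + u ∧
      SuffixOk k (downStep t) (h - d + u - 1) l' := by
  induction l with
  | nil =>
    intro prev h _ _ _ hl
    obtain ⟨rfl, hp⟩ := hl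
    exact Or.inl ⟨rfl, hp⟩
  | cons s l ih =>
    intro prev h hk hNE hE hl
    cases s with
    | NE =>
      obtain ⟨hk', hl⟩ := hl
      right
      rcases ih .NE (h + 1) hk' (by simp) (by simp) hl with ⟨-, hp⟩ | hr
      · simp at hp
      · obtain ⟨d, e, u, t, l', rfl, -, -, hd, he, -, hlt, hle, hl'⟩ := hr
        obtain rfl : d = 0 := by
          by_contra hne; simpa using hd (by omega)
        obtain rfl : e = 0 := by
          by_contra hne; exact he (by omega) rfl
        refine ⟨0, 0, u + 1, t, l', by simp [List.replicate_succ], by omega, by omega, by omega,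
          by omega, by omega, by omega, by omega, ?_⟩
        rwa [show h - 0 + (u + 1) - 1 = h + 1 - 0 + u - 1 by omega]
    | SE =>
      obtain ⟨hk', hl⟩ := hl
      by_cases hp : prev = .NE
      · exact Or.inr ⟨0, 0, 0, true, l, by simp [downStep], by omega, by omega, by omega,
          by omega, fun _ => hp, by omega, by omega, by simpa [downStep] using hl⟩
      have hdown : prev = .SE ∨ prev = .S := by
        cases prev <;> simp_all
      rcases ih .SE (h - 1) (by omega) (by simp) (by simp) hl with ⟨rfl, -⟩ | hr
      · refine Or.inl ⟨?_, hdown⟩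
        rw [← List.replicate_succ, Nat.sub_add_cancel hk']
      · obtain ⟨d, e, u, t, l', rfl, h1, h2, -, -, h3, hlt, hle, hl'⟩ := hr
        refine Or.inr ⟨d + 1, e, u, t, l', by simp [List.replicate_succ], by omega,
          fun he => by have := h2 he; omega, fun _ => hdown, fun _ => hp,
          fun hu => by simpa using h3 hu, by omega, by omega, ?_⟩
        rwa [show h - (d + 1) = h - 1 - d by omega]
    | S =>
      obtain ⟨hp, hk', hl⟩ := hl
      exact Or.inr ⟨0, 0, 0, false, l, by simp [downStep], by omega, by omega, by omega,
          by omega, fun _ => hp, by omega, by omega, by simpa [downStep] using hl⟩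
    | E =>
      obtain ⟨rfl, hl⟩ := hl
      have hp : prev ≠ .NE := fun hp => by simpa using hNE hp
      rcases ih .E 0 hk (by simp) (by simp) hl with ⟨-, hp⟩ | hr
      · simp at hp
      · obtain ⟨d, e, u, t, l', rfl, h1, -, -, -, h3, hlt, hle, hl'⟩ := hr
        obtain rfl : d = 0 := by omega
        exact Or.inr ⟨0, e + 1, u, t, l', by simp [List.replicate_succ], by omega, by omega,
          by omega, fun _ => hp, fun hu => by simpa using h3 hu, hlt, hle, hl'⟩

theorem buildPath_surjective {k h : ℕ} (N : ℕ) : ∀ (l : List PStep) (A B : ℕ) (prev : PStep),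
    l.length ≤ N → prev = .SE ∨ prev = .S → peakHeight h A B ≤ k →
    SuffixOk k prev (peakHeight h A B - 1) l →
    ∃ L, ColumnsOk k h A B L ∧ buildPath h A B L = l := by
  induction N with
  | zero =>
    intro l A B prev hN _ _ hl
    obtain rfl : l = [] := by simpa using hN
    exact ⟨[], trivial, by simp [buildPath, hl.1]⟩
  | succ N ih =>
    intro l A B prev hN hprev hk hl
    have hpos := peakHeight_pos h A B
    rcases suffixOk_decompose l prev _ (by omega) (by rintro rfl; simp at hprev)
      (by rintro rfl; simp at hprev) hl with ⟨rfl, -⟩ | hr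
    · exact ⟨[], trivial, rfl⟩
    · obtain ⟨d, e, u, t, l', rfl, hd, he, -, -, hu, hlt, hle, hl'⟩ := hr
      have hu' : 1 ≤ u := by
        by_contra hne
        obtain rfl : u = 0 := by omega
        rw [hu rfl] at hprev
        simp at hprev
      obtain ⟨A', B', hA, hB, rfl, rfl, rfl⟩ := segment_surjective (h := h) (A := A) (B := B)
        (d := d) (e := e) (u := u) (by omega) (fun h0 => by have := he h0; omega) hu'
      obtain ⟨-, -, h3, -, -⟩ := segment_spec (h := h) hA hB
      have hy : peakHeight h A B - 1 - descent h A B A' B' + ascent h A B A' B' =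
          peakHeight h A' B' := by omega
      rw [hy] at hlt hl'
      simp only [List.length_append, List.length_cons] at hN
      obtain ⟨L, hL, rfl⟩ := ih l' A' B' (downStep t) (by omega) (downStep_eq t) hlt.le hl'
      exact ⟨(A', B', t) :: L, ⟨hA, hB, hlt, hL⟩, rfl⟩

theorem card_paths_eq_card_columns {k i : ℕ} (n j N : ℕ) (hi : 1 ≤ i) (hik : i ≤ k) :
    Nat.card {l : List PStep // SpecialPath k i l ∧ majorIndex l = n ∧
        southSteps l = j ∧ numPeaks l = N} =
      Nat.card {L : List (ℕ × ℕ × Bool) // ColumnsOk k (k - i) 0 0 L ∧ columnsWeight 0 L = n ∧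
        plainCount L = j ∧ L.length = N} := by
  have hstart : peakHeight (k - i) 0 0 = k - i + 1 := by simp [peakHeight, add_comm]
  have hmajor {L} (hL : ColumnsOk k (k - i) 0 0 L) :
      (majorIndex (buildPath (k - i) 0 0 L) : ℤ) = columnsWeight 0 L := by
    rw [← majorFrom_zero, majorFrom_buildPath L 0 0 0 0 hL rfl]
  symm
  refine Nat.card_congr (Equiv.ofBijective (fun L => ⟨buildPath (k - i) 0 0 L.1, ?_⟩) ⟨?_, ?_⟩)
  · obtain ⟨L, hL, hn, hj, hN⟩ := L
    refine ⟨?_, ?_, ?_, ?_⟩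
    · rw [specialPath_iff hi hik]
      have := suffixOk_buildPath L 0 0 .SE (Or.inl rfl) hL
      rwa [hstart] at this
    · exact_mod_cast (hmajor hL).trans hn
    · rw [southSteps_buildPath, hj]
    · rw [numPeaks_buildPath L 0 0 hL, hN]
  · rintro ⟨L, hL, _⟩ ⟨L', hL', _⟩ heq
    exact Subtype.ext (buildPath_injective L L' 0 0 hL hL' (congrArg Subtype.val heq))
  · rintro ⟨l, hl, hn, hj, hN⟩
    rw [specialPath_iff hi hik] at hl
    obtain ⟨L, hL, rfl⟩ := buildPath_surjective (k := k) (h := k - i) l.length l 0 0 .SE le_rfl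
      (Or.inl rfl) (by omega) (by rwa [hstart])
    refine ⟨⟨L, hL, ?_, ?_, ?_⟩, rfl⟩
    · rw [← hmajor hL, hn]
    · rw [← hj, southSteps_buildPath]
    · rw [← hN, numPeaks_buildPath L 0 0 hL]

/-- The columns of a two-rowed array in shifted coordinates: `(a + 1, b + 1 + u, t)`, where `u`
counts the non-overlined parts to the right of `b` and `t` tells whether `b` is overlined. -/
def liftColumns : List ℕ → List (ℕ × Bool) → List (ℕ × ℕ × Bool)
  | a :: T, (b, t) :: B => (a + 1, b + 1 + B.countP (fun p => !p.2), t) :: liftColumns T B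
  | _, _ => []

/-- Strict domination of columns in both coordinates. -/
def Dominates (c d : ℕ × ℕ × Bool) : Prop := d.1 < c.1 ∧ d.2.1 < c.2.1

theorem columnsOk_iff (k h : ℕ) (L : List (ℕ × ℕ × Bool)) : ∀ (A B : ℕ) (t : Bool),
    ColumnsOk k h A B L ↔
      ((A, B, t) :: L).IsChain (fun c d => Dominates d c) ∧
        ∀ c ∈ L, peakHeight h c.1 c.2.1 < k := by
  induction L with
  | nil => simp [ColumnsOk]
  | cons c L ih =>
    obtain ⟨A', B', t'⟩ := c
    intro A B t
    simp only [ColumnsOk, ih A' B' t', List.isChain_cons_cons, List.forall_mem_cons, Dominates]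
    tauto

theorem columnsOk_reverse_iff (k h : ℕ) (M : List (ℕ × ℕ × Bool)) :
    ColumnsOk k h 0 0 M.reverse ↔
      (M ++ [(0, 0, true)]).IsChain Dominates ∧ ∀ c ∈ M, peakHeight h c.1 c.2.1 < k := by
  rw [columnsOk_iff k h _ 0 0 true, ← List.isChain_reverse (R := fun c d => Dominates d c)]
  simp

theorem columnsWeight_append (L : List (ℕ × ℕ × Bool)) (u A B : ℕ) (t : Bool) :
    columnsWeight u (L ++ [(A, B, t)]) =
      columnsWeight u L + ((A : ℤ) + B - 1 - u - plainCount L) := by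
  induction L generalizing u with
  | nil => simp [columnsWeight, plainCount]
  | cons c L ih =>
    obtain ⟨A', B', t'⟩ := c
    rw [List.cons_append, columnsWeight, columnsWeight, ih]
    cases t' <;> simp [plainCount] <;> ring

theorem plainCount_reverse (L : List (ℕ × ℕ × Bool)) : plainCount L.reverse = plainCount L := by
  simp [plainCount]

theorem plainCount_liftColumns (T : List ℕ) (B : List (ℕ × Bool)) (hlen : T.length = B.length) :
    plainCount (liftColumns T B) = B.countP fun p => !p.2 := by
  induction T generalizing B with
  | nil =>
    obtain rfl : B = [] := by simpa using hlen.symm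
    rfl
  | cons a T ih =>
    obtain _ | ⟨⟨b, t⟩, B⟩ := B
    · simp at hlen
    · have := ih B (by simpa using hlen)
      simp only [plainCount] at this ⊢
      simp [liftColumns, List.countP_cons, this]

theorem length_liftColumns (T : List ℕ) (B : List (ℕ × Bool)) (hlen : T.length = B.length) :
    (liftColumns T B).length = T.length := by
  induction T generalizing B with
  | nil => rfl
  | cons a T ih =>
    obtain _ | ⟨⟨b, t⟩, B⟩ := B
    · simp at hlen
    · simp [liftColumns, ih B (by simpa using hlen)]

theorem columnsWeight_liftColumns (T : List ℕ) (B : List (ℕ × Bool))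
    (hlen : T.length = B.length) :
    columnsWeight 0 (liftColumns T B).reverse =
      ((T.length + T.sum + (B.map Prod.fst).sum : ℕ) : ℤ) := by
  induction T generalizing B with
  | nil =>
    obtain rfl : B = [] := by simpa using hlen.symm
    rfl
  | cons a T ih =>
    obtain _ | ⟨⟨b, t⟩, B⟩ := B
    · simp at hlen
    · have hlen' : T.length = B.length := by simpa using hlen
      rw [liftColumns, List.reverse_cons, columnsWeight_append, ih B hlen', plainCount_reverse,
        plainCount_liftColumns T B hlen']
      simp only [List.length_cons, List.sum_cons, List.map_cons]
      push_cast
      ring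

theorem isChain_liftColumns (T : List ℕ) (B : List (ℕ × Bool)) (hlen : T.length = B.length) :
    (liftColumns T B ++ [(0, 0, true)]).IsChain Dominates ↔
      T.IsChain (· > ·) ∧ B.IsChain fun x y => y.1 < x.1 ∨ (x.1 = y.1 ∧ y.2 = false) := by
  induction T generalizing B with
  | nil =>
    obtain rfl : B = [] := by simpa using hlen.symm
    simp [liftColumns]
  | cons a T ih =>
    obtain _ | ⟨⟨b, t⟩, B⟩ := B
    · simp at hlen
    · have hlen' : T.length = B.length := by simpa using hlen
      have ih := ih B hlen'
      obtain _ | ⟨a', T⟩ := T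
      · obtain rfl : B = [] := by simpa using hlen'.symm
        simp [liftColumns, Dominates]
      · obtain _ | ⟨⟨b', t'⟩, B⟩ := B
        · simp at hlen'
        · simp only [liftColumns, List.cons_append, List.isChain_cons_cons, Dominates] at ih ⊢
          rw [ih]
          cases t' <;> simp <;> grind

theorem rankCond_iff {k i : ℕ} (hik : i ≤ k) (T : List ℕ) (B : List (ℕ × Bool))
    (hlen : T.length = B.length) :
    (∀ m : ℕ, m < T.length →
      -(i : ℤ) + 2 ≤ (T.getD m 0 : ℤ) - ((B.getD m (0, false)).1 : ℤ) -
        (((B.drop (m + 1)).filter fun p => !p.2).length : ℤ) ∧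
      (T.getD m 0 : ℤ) - ((B.getD m (0, false)).1 : ℤ) -
        (((B.drop (m + 1)).filter fun p => !p.2).length : ℤ) ≤ 2 * (k : ℤ) - i - 1) ↔
      ∀ c ∈ liftColumns T B, peakHeight (k - i) c.1 c.2.1 < k := by
  induction T generalizing B with
  | nil => simp [liftColumns]
  | cons a T ih =>
    obtain _ | ⟨⟨b, t⟩, B⟩ := B
    · simp at hlen
    · rw [liftColumns, List.forall_mem_cons, ← ih B (by simpa using hlen),
        ← Nat.and_forall_add_one]
      refine and_congr ?_ (by simp)
      simp only [List.length_cons, Nat.zero_lt_succ, forall_const, List.getD_cons_zero,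
        List.drop_succ_cons, List.drop_zero, ← List.countP_eq_length_filter, peakHeight]
      split_ifs <;> omega

theorem liftColumns_injective (T : List ℕ) (B : List (ℕ × Bool)) (T' : List ℕ)
    (B' : List (ℕ × Bool)) (hlen : T.length = B.length) (hlen' : T'.length = B'.length)
    (heq : liftColumns T B = liftColumns T' B') : T = T' ∧ B = B' := by
  induction T generalizing B T' B' with
  | nil =>
    obtain rfl : B = [] := by simpa using hlen.symm
    have h0 := congrArg List.length heq
    rw [length_liftColumns T' B' hlen'] at h0
    obtain rfl : T' = [] := by simpa [liftColumns] using h0.symm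
    obtain rfl : B' = [] := by simpa using hlen'.symm
    exact ⟨rfl, rfl⟩
  | cons a T ih =>
    obtain _ | ⟨⟨b, t⟩, B⟩ := B
    · simp at hlen
    obtain _ | ⟨a', T'⟩ := T'
    · simp [liftColumns] at heq
    obtain _ | ⟨⟨b', t'⟩, B'⟩ := B'
    · simp at hlen'
    simp only [liftColumns, List.cons.injEq, Prod.mk.injEq] at heq
    obtain ⟨⟨h1, h2, h3⟩, h4⟩ := heq
    obtain ⟨rfl, rfl⟩ := ih B T' B' (by simpa using hlen) (by simpa using hlen') h4
    simp only [List.cons.injEq, Prod.mk.injEq, and_true]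
    exact ⟨by omega, by omega, h3⟩

theorem liftColumns_surjective (M : List (ℕ × ℕ × Bool))
    (hM : (M ++ [(0, 0, true)]).IsChain Dominates) :
    ∃ T B, T.length = B.length ∧ liftColumns T B = M := by
  suffices ∃ T B, T.length = B.length ∧ liftColumns T B = M ∧
      ∀ c ∈ (M ++ [(0, 0, true)]).head?, B.countP (fun p => !p.2) ≤ c.2.1 by
    obtain ⟨T, B, h1, h2, -⟩ := this
    exact ⟨T, B, h1, h2⟩
  induction M with
  | nil => exact ⟨[], [], rfl, rfl, by simp⟩
  | cons c M ih =>
    obtain ⟨A, C, t⟩ := c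
    rw [List.cons_append, List.isChain_cons] at hM
    obtain ⟨T, B, h1, rfl, h3⟩ := ih hM.2
    obtain ⟨d, hd⟩ : ∃ d, d ∈ (liftColumns T B ++ [(0, 0, true)]).head? := by
      cases liftColumns T B <;> simp
    obtain ⟨hA, hC⟩ := hM.1 d hd
    have h3 := h3 d hd
    refine ⟨(A - 1) :: T, (C - 1 - B.countP (fun p => !p.2), t) :: B, by simp [h1], ?_, ?_⟩
    · simp only at hA hC
      simp only [liftColumns, List.cons.injEq, Prod.mk.injEq, and_true]
      omega
    · cases t <;> simp at hC ⊢ <;> omega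

theorem card_columns_eq_card_frobSym {k i : ℕ} (n j N : ℕ) (hik : i ≤ k) :
    Nat.card {L : List (ℕ × ℕ × Bool) // ColumnsOk k (k - i) 0 0 L ∧ columnsWeight 0 L = n ∧
        plainCount L = j ∧ L.length = N} =
      Nat.card {F : FrobSym //
        frobWeight F = n ∧ frobCols F = N ∧ botNonOverlined F = j ∧ RankCond k i F} := by
  have hrank (F : FrobSym) : RankCond k i F ↔
      ∀ c ∈ liftColumns F.top F.bot, peakHeight (k - i) c.1 c.2.1 < k :=
    rankCond_iff hik F.top F.bot F.len_eq
  have hplain (F : FrobSym) : plainCount (liftColumns F.top F.bot) = botNonOverlined F := by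
    rw [plainCount_liftColumns _ _ F.len_eq, botNonOverlined, List.countP_eq_length_filter]
  have hweight (F : FrobSym) :
      columnsWeight 0 (liftColumns F.top F.bot).reverse = frobWeight F :=
    columnsWeight_liftColumns _ _ F.len_eq
  symm
  refine Nat.card_congr (Equiv.ofBijective
    (fun F => ⟨(liftColumns F.1.top F.1.bot).reverse, ?_⟩) ⟨?_, ?_⟩)
  · obtain ⟨F, hn, hN, hj, hr⟩ := F
    refine ⟨?_, ?_, ?_, ?_⟩
    · rw [columnsOk_reverse_iff, isChain_liftColumns _ _ F.len_eq]
      exact ⟨⟨F.top_sorted, F.bot_sorted⟩, (hrank F).1 hr⟩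
    · rw [hweight, hn]
    · rw [plainCount_reverse, hplain, hj]
    · rw [List.length_reverse, length_liftColumns _ _ F.len_eq]
      exact hN
  · rintro ⟨⟨T, B, _, _, hlen⟩, _⟩ ⟨⟨T', B', _, _, hlen'⟩, _⟩ heq
    obtain ⟨rfl, rfl⟩ := liftColumns_injective T B T' B' hlen hlen'
      (List.reverse_injective (congrArg Subtype.val heq))
    rfl
  · rintro ⟨L, hL, hn, hj, hN⟩
    obtain ⟨M, rfl⟩ := List.reverse_surjective L
    rw [columnsOk_reverse_iff] at hL
    obtain ⟨T, B, hlen, rfl⟩ := liftColumns_surjective M hL.1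
    have hsorted := (isChain_liftColumns T B hlen).1 hL.1
    let F : FrobSym := ⟨T, B, hsorted.1, hsorted.2, hlen⟩
    refine ⟨⟨F, ?_, ?_, ?_, (hrank F).2 hL.2⟩, rfl⟩
    · exact_mod_cast (hweight F).symm.trans hn
    · rw [← hN, List.length_reverse, length_liftColumns T B hlen]
      rfl
    · rw [← hplain, ← plainCount_reverse]
      exact hj

/-- **Proposition 4.1.** The number of paths with major index `n`, `j` South steps and
`N` peaks satisfying the special `(k,i)`-conditions equals the number of
overpartitions of `n` whose Frobenius representation has `N` columns and `j`
non-overlined parts in the bottom row and whose successive ranks lie in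
`[-i+2, 2k-i-1]`. -/
theorem paths_ranks (k i n j N : ℕ) (hi : 1 ≤ i) (hik : i ≤ k) :
    Nat.card {l : List PStep // SpecialPath k i l ∧ majorIndex l = n ∧
        southSteps l = j ∧ numPeaks l = N} =
      Nat.card {F : FrobSym //
        frobWeight F = n ∧ frobCols F = N ∧ botNonOverlined F = j ∧ RankCond k i F} := by
  rw [card_paths_eq_card_columns n j N hi hik, card_columns_eq_card_frobSym n j N hik]

end Paper
end
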